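/- Let (Ω, μ) be a probability space, B ≥ 1 a real number, and (f_n)_n, (g_p)_p sequences of functions in L¹(μ) with every product f_n·g_p in L¹(μ), satisfying: (i) for each fixed n and each measurable set σ ⊆ Ω, the real sequence (∫_σ f_n g_p dμ)_p has bounded fluctuations with bound ε ↦ 8B²⌈1/ε⌉², and likewise for each fixed p and each measurable σ the sequence (∫_σ f_n g_p dμ)_n has bounded fluctuations with bound ε ↦ 8B²⌈1/ε⌉²; (ii) for each n, every ε > 0, and every measurable σ with μ(σ) < ε/(B·2^n), one has ∫_σ |f_n| dμ < ε; (iii) for each p, every ε > 0, and every measurable σ with μ(σ) < ε/(B·2^p), one has ∫_σ |g_p| dμ < ε; (iv) ‖f_n‖_{L¹} ≤ B for all n and ‖g_p‖_{L¹} ≤ B for all p. Then for every ε > 0 there exist indices m < s and q < l with s ≤ f_ω(2^22·B^4·⌈1/ε⌉^4 + 5) and l ≤ f_ω(2^22·B^4·⌈1/ε⌉^4 + 5) such that |∫ f_m g_s dμ − ∫ f_l g_q dμ| < 20ε. -/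

import Mathlib

open Filter MeasureTheory

/-- The fast-growing hierarchy: `f_0(n) = n+1`, `f_{m+1}(n) = f_m^[n](n)`. -/
def fgh : ℕ → ℕ → ℕ
  | 0 => fun n => n + 1
  | (m + 1) => fun n => (fgh m)^[n] n

/-- The diagonal of the fast-growing hierarchy, `f_ω(m) = f_m(m)`. -/
def fghOmega (m : ℕ) : ℕ := fgh m m

/-- A real sequence `a` has bounded fluctuations with bound `F`: for every `ε > 0`,
every nondecreasing `𝔪 : ℕ → ℕ` with `𝔪(n) ≥ n`, and every `n`, there is an
`m ∈ [n, 𝔪^[F ε](n)]` such that `|a_k − a_{k'}| < ε` for all `k, k' ∈ [m, 𝔪(m)]`. -/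
def HasBddFluct (a : ℕ → ℝ) (F : ℝ → ℕ) : Prop :=
  ∀ ε : ℝ, 0 < ε → ∀ M : ℕ → ℕ, Monotone M → (∀ n, n ≤ M n) → ∀ n : ℕ,
    ∃ m, n ≤ m ∧ m ≤ M^[F ε] n ∧
      ∀ k k', m ≤ k → k ≤ M m → m ≤ k' → k' ≤ M m → |a k - a k'| < ε

theorem fgh_succ (m n : ℕ) : fgh (m + 1) n = (fgh m)^[n] n := rfl

theorem fgh_mono_and_le (m : ℕ) : Monotone (fgh m) ∧ ∀ n, n ≤ fgh m n := by
  induction m with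
  | zero => exact ⟨fun a b h => Nat.succ_le_succ h, fun n => Nat.le_succ n⟩
  | succ m ih =>
    have hid : (id : ℕ → ℕ) ≤ fgh m := ih.2
    refine ⟨fun a b h => ?_, fun n => Function.id_le_iterate_of_id_le hid n n⟩
    calc (fgh m)^[a] a ≤ (fgh m)^[b] a := Function.monotone_iterate_of_id_le hid h a
      _ ≤ (fgh m)^[b] b := ih.1.iterate b h

theorem fgh_mono (m : ℕ) : Monotone (fgh m) := (fgh_mono_and_le m).1

theorem le_fgh (m n : ℕ) : n ≤ fgh m n := (fgh_mono_and_le m).2 n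

theorem fgh_iterate_mono (m : ℕ) {i j x y : ℕ} (hij : i ≤ j) (hxy : x ≤ y) :
    (fgh m)^[i] x ≤ (fgh m)^[j] y :=
  (Function.monotone_iterate_of_id_le (le_fgh m : (id : ℕ → ℕ) ≤ fgh m) hij x).trans
    ((fgh_mono m).iterate j hxy)

theorem fgh_le_fgh_succ (m : ℕ) {n : ℕ} (hn : 1 ≤ n) : fgh m n ≤ fgh (m + 1) n :=
  fgh_iterate_mono m (i := 1) hn le_rfl

theorem fgh_level_mono {m k n : ℕ} (hmk : m ≤ k) (hn : 1 ≤ n) : fgh m n ≤ fgh k n := by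
  induction k, hmk using Nat.le_induction with
  | base => exact le_rfl
  | succ k _ ih => exact ih.trans (fgh_le_fgh_succ k hn)

theorem lt_fgh (m : ℕ) {n : ℕ} (hn : 1 ≤ n) : n < fgh m n :=
  lt_of_lt_of_le (Nat.lt_succ_self n) (fgh_level_mono (Nat.zero_le m) hn)

theorem fgh_one (n : ℕ) : fgh 1 n = 2 * n := by
  have h : ∀ i x : ℕ, (fgh 0)^[i] x = x + i := by
    intro i
    induction i with
    | zero => intro x; rfl
    | succ i ih => intro x; rw [Function.iterate_succ_apply, ih]; simp only [fgh]; omega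
  rw [fgh_succ, h]; omega

theorem fgh_two (n : ℕ) : fgh 2 n = 2 ^ n * n := by
  have h : ∀ i x : ℕ, (fgh 1)^[i] x = 2 ^ i * x := by
    intro i
    induction i with
    | zero => intro x; simp
    | succ i ih => intro x; rw [Function.iterate_succ_apply, ih, fgh_one]; ring
  rw [fgh_succ, h]

theorem two_pow_le_fgh_two {n : ℕ} (hn : 1 ≤ n) : 2 ^ n ≤ fgh 2 n := by
  rw [fgh_two]; exact Nat.le_mul_of_pos_right _ hn

theorem three_fold_fgh_two_le {n : ℕ} (hn : 3 ≤ n) : fgh 2 (fgh 2 (fgh 2 n)) ≤ fgh 3 n :=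
  fgh_iterate_mono 2 (i := 3) hn le_rfl

/-- Two nested bounded iterations of a level cost at most three levels. -/
theorem nested_iterate_le_fgh {m x : ℕ} (hx : 2 ≤ x) {R : ℕ → ℕ} {Q : ℕ}
    (hR : ∀ y, x ≤ y → R y ≤ fgh (m + 1) y) (hR' : ∀ y, x ≤ y → y ≤ R y)
    (hQ : 2 * Q ≤ fgh (m + 2) x) :
    (fun y => (fgh m)^[R y] y)^[Q] x ≤ fgh (m + 3) x := by
  have hstep : ∀ t, x ≤ (fun y => (fgh m)^[R y] y)^[t] x ∧
      (fun y => (fgh m)^[R y] y)^[t] x ≤ (fgh (m + 1))^[2 * t] x := by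
    intro t
    induction t with
    | zero => exact ⟨le_rfl, le_rfl⟩
    | succ t ih =>
      rw [Function.iterate_succ_apply']
      set y := (fun y => (fgh m)^[R y] y)^[t] x
      refine ⟨ih.1.trans (fgh_iterate_mono m (Nat.zero_le (R y)) (le_refl y)), ?_⟩
      calc (fgh m)^[R y] y ≤ (fgh m)^[R y] (R y) := fgh_iterate_mono m le_rfl (hR' y ih.1)
        _ = fgh (m + 1) (R y) := rfl
        _ ≤ fgh (m + 1) (fgh (m + 1) y) := fgh_mono _ (hR y ih.1)
        _ ≤ fgh (m + 1) (fgh (m + 1) ((fgh (m + 1))^[2 * t] x)) :=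
            fgh_mono _ (fgh_mono _ ih.2)
        _ = (fgh (m + 1))^[2 * (t + 1)] x := by
            rw [show 2 * (t + 1) = (2 * t + 1) + 1 by ring, Function.iterate_succ_apply',
              Function.iterate_succ_apply']
  calc (fun y => (fgh m)^[R y] y)^[Q] x ≤ (fgh (m + 1))^[2 * Q] x := (hstep Q).2
    _ ≤ (fgh (m + 1))^[fgh (m + 2) x] (fgh (m + 2) x) :=
        fgh_iterate_mono _ hQ (le_fgh _ _)
    _ = (fgh (m + 2))^[2] x := rfl
    _ ≤ (fgh (m + 2))^[x] x := fgh_iterate_mono _ hx le_rfl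
    _ = fgh (m + 3) x := rfl

/-! ### Chains and ranks -/

/-- `HasChain P t b` says that there are `b < n₁ < ⋯ < n_t` whose consecutive pairs satisfy `P`. -/
def HasChain (P : ℕ → ℕ → Prop) : ℕ → ℕ → Prop
  | 0 => fun _ => True
  | (t + 1) => fun b => ∃ n, b < n ∧ P b n ∧ HasChain P t n

open Classical in
/-- The length, capped at `F`, of the longest `P`-chain starting from `b`. -/
noncomputable def chainRank (P : ℕ → ℕ → Prop) (F b : ℕ) : ℕ :=
  Nat.findGreatest (fun t => HasChain P t b) F

theorem HasChain.exists_seq {P : ℕ → ℕ → Prop} {t b : ℕ} (h : HasChain P t b) :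
    ∃ u : ℕ → ℕ, StrictMono u ∧ u 0 = b ∧ ∀ i < t, P (u i) (u (i + 1)) := by
  induction t generalizing b with
  | zero =>
    exact ⟨fun i => b + i, fun i j hij => Nat.add_lt_add_left hij b, rfl,
      fun i hi => absurd hi (Nat.not_lt_zero i)⟩
  | succ t ih =>
    obtain ⟨n, hbn, hP, hn⟩ := h
    obtain ⟨u, hu, hu0, hstep⟩ := ih hn
    refine ⟨fun i => Nat.casesOn i b u, strictMono_nat_of_lt_succ ?_, rfl, ?_⟩
    · intro i
      cases i with
      | zero => simpa [hu0] using hbn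
      | succ i => exact hu (Nat.lt_succ_self i)
    · intro i hi
      cases i with
      | zero => simpa [hu0] using hP
      | succ i => exact hstep i (Nat.lt_of_succ_lt_succ hi)

theorem HasChain.anti {P : ℕ → ℕ → Prop} (hP : ∀ b b' n, b ≤ b' → P b' n → P b n)
    {t b b' : ℕ} (hb : b ≤ b') (h : HasChain P t b') : HasChain P t b := by
  cases t with
  | zero => trivial
  | succ t =>
    obtain ⟨n, hbn, hn, ht⟩ := h
    exact ⟨n, hb.trans_lt hbn, hP b b' n hb hn, ht⟩

theorem chainRank_le (P : ℕ → ℕ → Prop) (F b : ℕ) : chainRank P F b ≤ F := by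
  classical exact Nat.findGreatest_le F

theorem hasChain_chainRank (P : ℕ → ℕ → Prop) (F b : ℕ) :
    HasChain P (chainRank P F b) b := by
  classical
  exact Nat.findGreatest_spec (P := fun t => HasChain P t b) (Nat.zero_le F) trivial

theorem le_chainRank {P : ℕ → ℕ → Prop} {F b t : ℕ} (ht : t ≤ F) (h : HasChain P t b) :
    t ≤ chainRank P F b := by
  classical
  exact Nat.le_findGreatest ht h

theorem chainRank_anti {P : ℕ → ℕ → Prop} (hP : ∀ b b' n, b ≤ b' → P b' n → P b n)
    (F : ℕ) : Antitone (chainRank P F) := fun _ b' hb =>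
  le_chainRank (chainRank_le P F b') ((hasChain_chainRank P F b').anti hP hb)

theorem not_of_chainRank_le {P : ℕ → ℕ → Prop} (hP : ∀ b b' n, b ≤ b' → P b' n → P b n)
    {F : ℕ} (hno : ∀ b, ¬ HasChain P (F + 1) b) {b n c : ℕ} (hbn : b < n) (hnc : n ≤ c)
    (h : chainRank P F b ≤ chainRank P F c) : ¬ P b n := by
  intro hPbn
  have hchain : HasChain P (chainRank P F n + 1) b := ⟨n, hbn, hPbn, hasChain_chainRank P F n⟩
  have hcn := chainRank_anti hP F hnc
  rcases (chainRank_le P F n).lt_or_eq with hlt | heq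
  · have := le_chainRank (Nat.succ_le_of_lt hlt) hchain
    omega
  · exact hno b (heq ▸ hchain)

/-! ### Fluctuations of integrals -/

/-- Somewhere on `[b, n]` the sequence `a` has two values at distance at least `θ`. -/
def Oscillates (θ : ℝ) (a : ℕ → ℝ) (b n : ℕ) : Prop :=
  ∃ i j, b ≤ i ∧ i ≤ n ∧ b ≤ j ∧ j ≤ n ∧ θ ≤ |a i - a j|

/-- Some set carries mass at least `θ` of `|h n|` but mass less than `η` of each
`|h i|` with `i ≤ b`. -/
def Escapes {Ω : Type*} [MeasurableSpace Ω] (μ : Measure Ω) (η θ : ℝ) (h : ℕ → Ω → ℝ)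
    (b n : ℕ) : Prop :=
  ∃ τ : Set Ω, MeasurableSet τ ∧ (∀ i ≤ b, (∫ x in τ, |h i x| ∂μ) < η) ∧
    θ ≤ ∫ x in τ, |h n x| ∂μ

theorem Oscillates.anti {θ : ℝ} {a : ℕ → ℝ} (b b' n : ℕ) (hb : b ≤ b')
    (h : Oscillates θ a b' n) : Oscillates θ a b n := by
  obtain ⟨i, j, hi, hi', hj, hj', hθ⟩ := h
  exact ⟨i, j, hb.trans hi, hi', hb.trans hj, hj', hθ⟩

theorem Escapes.anti {Ω : Type*} [MeasurableSpace Ω] {μ : Measure Ω} {η θ : ℝ}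
    {h : ℕ → Ω → ℝ} (b b' n : ℕ) (hb : b ≤ b') (H : Escapes μ η θ h b' n) :
    Escapes μ η θ h b n := by
  obtain ⟨τ, hτ, hs, hn⟩ := H
  exact ⟨τ, hτ, fun i hi => hs i (hi.trans hb), hn⟩

theorem HasBddFluct.exists_not_oscillates {a : ℕ → ℝ} {F : ℝ → ℕ} (ha : HasBddFluct a F)
    {θ : ℝ} (hθ : 0 < θ) {u : ℕ → ℕ} (hu : StrictMono u) :
    ∃ i ≤ F θ, ¬ Oscillates θ a (u i) (u (i + 1)) := by
  classical
  have hex : ∀ k, ∃ i, k ≤ u i := fun k => ⟨k, hu.id_le k⟩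
  set M : ℕ → ℕ := fun k => u (Nat.find (hex k) + 1) with hM
  have hMmono : Monotone M := fun k l hkl =>
    hu.monotone (Nat.succ_le_succ (Nat.find_min' _ (hkl.trans (Nat.find_spec (hex l)))))
  have hMle : ∀ k, k ≤ M k := fun k =>
    (Nat.find_spec (hex k)).trans (hu.monotone (Nat.le_succ _))
  have hMu : ∀ i, M (u i) = u (i + 1) := by
    intro i
    have : Nat.find (hex (u i)) = i :=
      le_antisymm (Nat.find_min' _ le_rfl) (hu.le_iff_le.1 (Nat.find_spec (hex (u i))))
    simp only [hM, this]
  have hiter : ∀ i, M^[i] (u 0) = u i := by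
    intro i
    induction i with
    | zero => rfl
    | succ i ih => rw [Function.iterate_succ_apply', ih, hMu]
  obtain ⟨m, _, hm, hstable⟩ := ha θ hθ M hMmono hMle (u 0)
  rw [hiter] at hm
  refine ⟨Nat.find (hex m), Nat.find_min' _ hm, ?_⟩
  rintro ⟨i, j, hi, hi', hj, hj', hij⟩
  have hmu := Nat.find_spec (hex m)
  exact absurd (hstable i j (hmu.trans hi) hi' (hmu.trans hj) hj') (not_lt.2 hij)

theorem not_hasChain_oscillates {a : ℕ → ℝ} {F : ℝ → ℕ} (ha : HasBddFluct a F)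
    {θ : ℝ} (hθ : 0 < θ) (b : ℕ) : ¬ HasChain (Oscillates θ a) (F θ + 1) b := by
  intro h
  obtain ⟨u, hu, _, hstep⟩ := h.exists_seq
  obtain ⟨i, hi, hno⟩ := ha.exists_not_oscillates hθ hu
  exact hno (hstep i (Nat.lt_succ_of_le hi))

theorem exists_subset_quarter_le {Ω : Type*} [MeasurableSpace Ω] {μ : Measure Ω}
    {h : Ω → ℝ} (hm : Measurable h) (hi : Integrable h μ) {σ τ : Set Ω}
    (hσ : MeasurableSet σ) (hτ : MeasurableSet τ) {θ : ℝ}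
    (hθ : 4 * θ ≤ ∫ x in τ, |h x| ∂μ) :
    ∃ ρ ⊆ τ, MeasurableSet ρ ∧ (ρ ⊆ σ ∨ Disjoint ρ σ) ∧ θ ≤ |∫ x in ρ, h x ∂μ| := by
  have hpos : MeasurableSet {x | 0 ≤ h x} := measurableSet_le measurable_const hm
  have habs : ∀ ρ : Set Ω, MeasurableSet ρ → (∀ x ∈ ρ, 0 ≤ h x) →
      (∫ x in ρ, |h x| ∂μ) ≤ |∫ x in ρ, h x ∂μ| := by
    intro ρ hρ hx
    rw [setIntegral_congr_fun hρ (fun x hxρ => abs_of_nonneg (hx x hxρ))]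
    exact le_abs_self _
  have habs' : ∀ ρ : Set Ω, MeasurableSet ρ → (∀ x ∈ ρ, h x ≤ 0) →
      (∫ x in ρ, |h x| ∂μ) ≤ |∫ x in ρ, h x ∂μ| := by
    intro ρ hρ hx
    rw [setIntegral_congr_fun hρ (fun x hxρ => abs_of_nonpos (hx x hxρ)), integral_neg]
    exact neg_le_abs _
  have hsplit : ∀ ρ κ : Set Ω, MeasurableSet κ →
      (∫ x in ρ, |h x| ∂μ) = (∫ x in ρ ∩ κ, |h x| ∂μ) + ∫ x in ρ \ κ, |h x| ∂μ :=
    fun ρ κ hκ => (integral_inter_add_sdiff hκ hi.abs.integrableOn).symm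
  by_contra! hcon
  have key : ∀ ρ ⊆ τ, MeasurableSet ρ → (ρ ⊆ σ ∨ Disjoint ρ σ) →
      (∫ x in ρ, |h x| ∂μ) < 2 * θ := by
    intro ρ hρτ hρ hρσ
    have hsub : ∀ κ : Set Ω, κ ⊆ ρ → (κ ⊆ σ ∨ Disjoint κ σ) := fun κ hκ =>
      hρσ.imp hκ.trans (fun hd => hd.mono_left hκ)
    have h1 := (habs _ (hρ.inter hpos) (fun x hx => hx.2)).trans_lt
      (hcon _ (Set.inter_subset_left.trans hρτ) (hρ.inter hpos)
        (hsub _ Set.inter_subset_left))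
    have h2 := (habs' _ (hρ.diff hpos) (fun x hx => (not_le.1 hx.2).le)).trans_lt
      (hcon _ (Set.sdiff_subset.trans hρτ) (hρ.diff hpos) (hsub _ Set.sdiff_subset))
    rw [hsplit ρ _ hpos]
    linarith
  have h1 := key _ Set.inter_subset_left (hτ.inter hσ) (Or.inl Set.inter_subset_right)
  have h2 := key _ Set.sdiff_subset (hτ.diff hσ) (Or.inr Set.disjoint_sdiff_left)
  rw [hsplit τ σ hσ] at hθ
  linarith

/-- A chain of escapes of mass is witnessed by the fluctuations on a single set. -/
theorem exists_set_of_escapes {Ω : Type*} [MeasurableSpace Ω] {μ : Measure Ω}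
    {h : ℕ → Ω → ℝ} (hm : ∀ n, Measurable (h n)) (hi : ∀ n, Integrable (h n) μ)
    {η θ : ℝ} {u : ℕ → ℕ} (hu : StrictMono u) (T : ℕ)
    (hesc : ∀ i < T, Escapes μ η (8 * θ) h (u i) (u (i + 1))) :
    ∃ σ, MeasurableSet σ ∧ ∀ i < T,
      θ - 2 * η * T ≤ |(∫ x in σ, h (u i) x ∂μ) - ∫ x in σ, h (u (i + 1)) x ∂μ| := by
  induction T with
  | zero => exact ⟨∅, MeasurableSet.empty, fun i hi => absurd hi (Nat.not_lt_zero i)⟩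
  | succ T ih =>
    obtain ⟨σ, hσ, hjump⟩ := ih fun i hi => hesc i (hi.trans (Nat.lt_succ_self T))
    obtain ⟨τ, hτ, hsmall, hlarge⟩ := hesc T (Nat.lt_succ_self T)
    obtain ⟨ρ, hρτ, hρ, hρσ, hρlarge⟩ := exists_subset_quarter_le (θ := 2 * θ)
      (hm _) (hi _) hσ hτ (by linarith)
    have hη : 0 ≤ η := (integral_nonneg fun x => abs_nonneg (h (u T) x)).trans
      (hsmall _ le_rfl).le
    have hρsmall : ∀ i ≤ u T, |∫ x in ρ, h i x ∂μ| ≤ η := fun i hiT =>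
      abs_integral_le_integral_abs.trans ((setIntegral_mono_set (hi i).abs.integrableOn
        (Eventually.of_forall fun x => abs_nonneg _) hρτ.eventuallyLE).trans
        (hsmall i hiT).le)
    obtain ⟨σ', hσ', hσσ'⟩ : ∃ σ', MeasurableSet σ' ∧ ∀ n,
        |(∫ x in σ', h n x ∂μ) - ∫ x in σ, h n x ∂μ| = |∫ x in ρ, h n x ∂μ| := by
      rcases hρσ with hsub | hdisj
      · refine ⟨σ \ ρ, hσ.diff hρ, fun n => ?_⟩
        rw [setIntegral_sdiff hρ (hi n).integrableOn hsub, sub_sub_cancel_left, abs_neg]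
      · refine ⟨σ ∪ ρ, hσ.union hρ, fun n => ?_⟩
        rw [setIntegral_union hdisj.symm hρ (hi n).integrableOn (hi n).integrableOn,
          add_sub_cancel_left]
    have hold : ∀ i < T, u i ≤ u T ∧ u (i + 1) ≤ u T := fun i hiT =>
      ⟨hu.monotone hiT.le, hu.monotone hiT⟩
    push_cast
    by_cases hnew : θ - 2 * η * (T + 1) ≤
        |(∫ x in σ, h (u T) x ∂μ) - ∫ x in σ, h (u (T + 1)) x ∂μ|
    · refine ⟨σ, hσ, fun i hi' => ?_⟩
      rcases Nat.lt_succ_iff_lt_or_eq.1 hi' with hlt | rfl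
      · linarith [hjump i hlt]
      · exact hnew
    · refine ⟨σ', hσ', fun i hi' => ?_⟩
      rcases Nat.lt_succ_iff_lt_or_eq.1 hi' with hlt | rfl
      · have h1 := (hσσ' (u i)).le.trans (hρsmall _ (hold i hlt).1)
        have h2 := (hσσ' (u (i + 1))).le.trans (hρsmall _ (hold i hlt).2)
        have h3 := hjump i hlt
        rw [abs_le] at h1 h2
        rcases le_abs.1 h3 with h3 | h3
        · exact le_abs.2 (Or.inl (by linarith))
        · exact le_abs.2 (Or.inr (by linarith))
      · have h1 := (hσσ' (u i)).le.trans (hρsmall _ le_rfl)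
        have h2 := hρlarge.trans (hσσ' (u (i + 1))).ge
        have hT : 0 ≤ 2 * η * i := by positivity
        rw [not_le, abs_lt] at hnew
        rw [abs_le] at h1
        rcases le_abs.1 h2 with h2 | h2
        · exact le_abs.2 (Or.inr (by linarith))
        · exact le_abs.2 (Or.inl (by linarith))

theorem not_hasChain_escapes {Ω : Type*} [MeasurableSpace Ω] {μ : Measure Ω}
    {h : ℕ → Ω → ℝ} (hm : ∀ n, Measurable (h n)) (hi : ∀ n, Integrable (h n) μ)
    {Φ : ℝ → ℕ} (hfl : ∀ σ, MeasurableSet σ → HasBddFluct (fun n => ∫ x in σ, h n x ∂μ) Φ)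
    {θ : ℝ} (hθ : 0 < θ) (b : ℕ) :
    ¬ HasChain (Escapes μ (θ / (2 * (Φ θ + 1))) (16 * θ) h) (Φ θ + 1) b := by
  intro hch
  obtain ⟨u, hu, _, hstep⟩ := hch.exists_seq
  obtain ⟨σ, hσ, hjump⟩ := exists_set_of_escapes (θ := 2 * θ) hm hi hu (Φ θ + 1)
    (fun i hiT => by have := hstep i hiT; rwa [show 8 * (2 * θ) = 16 * θ by ring])
  obtain ⟨i, hi', hno⟩ := (hfl σ hσ).exists_not_oscillates hθ hu
  refine hno ⟨u i, u (i + 1), le_rfl, hu.monotone (Nat.le_succ i), hu.monotone (Nat.le_succ i),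
    le_rfl, ?_⟩
  have h1 := hjump i (Nat.lt_succ_of_le hi')
  have h2 : 2 * θ - 2 * (θ / (2 * (Φ θ + 1))) * ((Φ θ + 1 : ℕ) : ℝ) = θ := by
    push_cast
    field_simp
    ring
  linarith

/-- The combined rank of a family at scale `θ`, with chain lengths capped at `F`. -/
noncomputable def fluctRank {Ω : Type*} [MeasurableSpace Ω] (μ : Measure Ω) (θ : ℝ) (F : ℕ)
    (h : ℕ → Ω → ℝ) (b : ℕ) : ℕ :=
  chainRank (Oscillates θ fun n => ∫ x, h n x ∂μ) F b +
    chainRank (Escapes μ (θ / (2 * (F + 1))) (16 * θ) h) F b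

theorem fluctRank_le {Ω : Type*} [MeasurableSpace Ω] (μ : Measure Ω) (θ : ℝ) (F : ℕ)
    (h : ℕ → Ω → ℝ) (b : ℕ) : fluctRank μ θ F h b ≤ 2 * F := by
  have h1 := chainRank_le (Oscillates θ fun n => ∫ x, h n x ∂μ) F b
  have h2 := chainRank_le (Escapes μ (θ / (2 * (F + 1))) (16 * θ) h) F b
  unfold fluctRank
  omega

theorem fluctRank_anti {Ω : Type*} [MeasurableSpace Ω] (μ : Measure Ω) (θ : ℝ) (F : ℕ)
    (h : ℕ → Ω → ℝ) : Antitone (fluctRank μ θ F h) := fun _ _ hb =>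
  Nat.add_le_add (chainRank_anti Oscillates.anti F hb) (chainRank_anti Escapes.anti F hb)

theorem fluctRank_stable {Ω : Type*} [MeasurableSpace Ω] {μ : Measure Ω}
    {h : ℕ → Ω → ℝ} (hm : ∀ n, Measurable (h n)) (hi : ∀ n, Integrable (h n) μ)
    {Φ : ℝ → ℕ} (hfl : ∀ σ, MeasurableSet σ → HasBddFluct (fun n => ∫ x in σ, h n x ∂μ) Φ)
    {θ : ℝ} (hθ : 0 < θ) {b c : ℕ}
    (hr : fluctRank μ θ (Φ θ) h b ≤ fluctRank μ θ (Φ θ) h c) :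
    (∀ n, b ≤ n → n ≤ c → |(∫ x, h b x ∂μ) - ∫ x, h n x ∂μ| < θ) ∧
    ∀ n, b < n → n ≤ c → ∀ τ, MeasurableSet τ →
      (∀ i ≤ b, (∫ x in τ, |h i x| ∂μ) < θ / (2 * (Φ θ + 1))) →
      (∫ x in τ, |h n x| ∂μ) < 16 * θ := by
  have hfl' : HasBddFluct (fun n => ∫ x, h n x ∂μ) Φ := by
    simpa using hfl Set.univ MeasurableSet.univ
  have hsplit : ∀ n, b < n → n ≤ c → ¬ Oscillates θ (fun n => ∫ x, h n x ∂μ) b n ∧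
      ¬ Escapes μ (θ / (2 * (Φ θ + 1))) (16 * θ) h b n := by
    intro n hbn hnc
    have hbc := hbn.le.trans hnc
    have h1 := chainRank_anti (P := Oscillates θ fun n => ∫ x, h n x ∂μ)
      Oscillates.anti (Φ θ) hbc
    have h2 := chainRank_anti (P := Escapes μ (θ / (2 * (Φ θ + 1))) (16 * θ) h)
      Escapes.anti (Φ θ) hbc
    unfold fluctRank at hr
    exact ⟨not_of_chainRank_le Oscillates.anti (not_hasChain_oscillates hfl' hθ) hbn hnc
        (by omega),
      not_of_chainRank_le Escapes.anti (not_hasChain_escapes hm hi hfl hθ) hbn hnc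
        (by omega)⟩
  refine ⟨fun n hbn hnc => ?_, fun n hbn hnc τ hτ hs => ?_⟩
  · rcases hbn.eq_or_lt with rfl | hlt
    · simpa using hθ
    · by_contra hcon
      exact (hsplit n hlt hnc).1 ⟨b, n, le_rfl, hbn, hbn, le_rfl, not_lt.1 hcon⟩
  · by_contra hcon
    exact (hsplit n hbn hnc).2 ⟨τ, hτ, hs, not_lt.1 hcon⟩

/-! ### Order-separated pairings of bounded functions -/

/-- Iterated averages over consecutive dyadic blocks: `dyadicAvg x t j` is the mean of
`x j, …, x (j + 2 ^ t - 1)`. -/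
noncomputable def dyadicAvg {Ω : Type*} (x : ℕ → Ω → ℝ) : ℕ → ℕ → Ω → ℝ
  | 0 => x
  | (t + 1) => fun j ω => (dyadicAvg x t j ω + dyadicAvg x t (j + 2 ^ t) ω) / 2

theorem measurable_dyadicAvg {Ω : Type*} [MeasurableSpace Ω] {x : ℕ → Ω → ℝ}
    (hx : ∀ i, Measurable (x i)) (t j : ℕ) : Measurable (dyadicAvg x t j) := by
  induction t generalizing j with
  | zero => exact hx j
  | succ t ih => exact ((ih j).add (ih _)).div_const 2

theorem abs_dyadicAvg_le {Ω : Type*} {x : ℕ → Ω → ℝ} {Λ : ℝ}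
    (hx : ∀ i ω, |x i ω| ≤ Λ) (t j : ℕ) (ω : Ω) : |dyadicAvg x t j ω| ≤ Λ := by
  induction t generalizing j with
  | zero => exact hx j ω
  | succ t ih =>
    have h1 := abs_le.1 (ih j)
    have h2 := abs_le.1 (ih (j + 2 ^ t))
    simp only [dyadicAvg]
    exact abs_le.2 ⟨by linarith, by linarith⟩

theorem integrable_mul_of_abs_le {Ω : Type*} [MeasurableSpace Ω] {μ : Measure Ω}
    [IsFiniteMeasure μ] {v w : Ω → ℝ} (hv : Measurable v) (hw : Measurable w) {C C' : ℝ}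
    (hvC : ∀ ω, |v ω| ≤ C) (hwC : ∀ ω, |w ω| ≤ C') :
    Integrable (fun ω => v ω * w ω) μ := by
  refine Integrable.of_bound (hv.mul hw).aestronglyMeasurable (C * C')
    (Eventually.of_forall fun ω => ?_)
  rw [Real.norm_eq_abs, abs_mul]
  exact mul_le_mul (hvC ω) (hwC ω) (abs_nonneg _) ((abs_nonneg _).trans (hvC ω))

theorem abs_integral_dyadicAvg_mul_sub_le {Ω : Type*} [MeasurableSpace Ω] {μ : Measure Ω}
    [IsProbabilityMeasure μ] {x : ℕ → Ω → ℝ} {y : Ω → ℝ} {Λ r v : ℝ}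
    (hx : ∀ i, Measurable (x i)) (hy : Measurable y)
    (hxΛ : ∀ i ω, |x i ω| ≤ Λ) (hyΛ : ∀ ω, |y ω| ≤ Λ) (t j : ℕ)
    (h : ∀ i, j ≤ i → i < j + 2 ^ t → |(∫ ω, x i ω * y ω ∂μ) - v| ≤ r) :
    |(∫ ω, dyadicAvg x t j ω * y ω ∂μ) - v| ≤ r := by
  induction t generalizing j with
  | zero => exact h j le_rfl (by simp)
  | succ t ih =>
    have hpow : 2 ^ (t + 1) = 2 ^ t + 2 ^ t := by ring
    have h1 := abs_le.1 (ih j fun i hi hi' => h i hi (by omega))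
    have h2 := abs_le.1 (ih (j + 2 ^ t) fun i hi hi' => h i (by omega) (by omega))
    have hxy : ∀ k, Integrable (fun ω => dyadicAvg x t k ω * y ω) μ := fun k =>
      integrable_mul_of_abs_le (measurable_dyadicAvg hx t k) hy
        (abs_dyadicAvg_le hxΛ t k) hyΛ
    have h3 : (∫ ω, dyadicAvg x (t + 1) j ω * y ω ∂μ) =
        ((∫ ω, dyadicAvg x t j ω * y ω ∂μ) +
          ∫ ω, dyadicAvg x t (j + 2 ^ t) ω * y ω ∂μ) / 2 := by
      rw [← integral_add (hxy _) (hxy _), ← integral_div]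
      congr 1
      funext ω
      simp only [dyadicAvg]
      ring
    rw [h3]
    exact abs_le.2 ⟨by linarith, by linarith⟩

theorem sq_le_integral_sq_mul_sq {Ω : Type*} [MeasurableSpace Ω] {μ : Measure Ω}
    [IsProbabilityMeasure μ] {v y : Ω → ℝ} {C Λ c : ℝ} (hv : Measurable v)
    (hy : Measurable y) (hvC : ∀ ω, |v ω| ≤ C) (hyΛ : ∀ ω, |y ω| ≤ Λ) (hΛ : 0 < Λ)
    (hc : 0 < c) (h : c ≤ |∫ ω, v ω * y ω ∂μ|) :
    c ^ 2 / Λ ^ 2 ≤ ∫ ω, v ω * v ω ∂μ := by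
  have hvv := integrable_mul_of_abs_le (μ := μ) hv hv hvC hvC
  have hvy := integrable_mul_of_abs_le (μ := μ) hv hy hvC hyΛ
  have hyy := integrable_mul_of_abs_le (μ := μ) hy hy hyΛ hyΛ
  have hyle : (∫ ω, y ω * y ω ∂μ) ≤ Λ ^ 2 := by
    calc (∫ ω, y ω * y ω ∂μ) ≤ ∫ _, Λ ^ 2 ∂μ := by
          refine integral_mono hyy (integrable_const _) fun ω => ?_
          have := abs_le.1 (hyΛ ω)
          simp only
          nlinarith
      _ = Λ ^ 2 := by simp
  have key : ∀ s : ℝ, 0 ≤ (∫ ω, v ω * v ω ∂μ) - 2 * s * (∫ ω, v ω * y ω ∂μ) +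
      s ^ 2 * ∫ ω, y ω * y ω ∂μ := by
    intro s
    have hsub : Integrable (fun ω => v ω * v ω - 2 * s * (v ω * y ω)) μ :=
      hvv.sub (hvy.const_mul _)
    rw [← integral_const_mul, ← integral_const_mul, ← integral_sub hvv (hvy.const_mul _),
      ← integral_add hsub (hyy.const_mul _)]
    refine integral_nonneg fun ω => ?_
    have := sq_nonneg (v ω - s * y ω)
    simp only [Pi.zero_apply]
    nlinarith
  have hs : ∀ s : ℝ, s ^ 2 = (c / Λ ^ 2) ^ 2 →
      s * (∫ ω, v ω * y ω ∂μ) = c / Λ ^ 2 * |∫ ω, v ω * y ω ∂μ| →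
      c ^ 2 / Λ ^ 2 ≤ ∫ ω, v ω * v ω ∂μ := by
    intro s h1 h2
    have h3 := key s
    have h4 : s ^ 2 * (∫ ω, y ω * y ω ∂μ) ≤ (c / Λ ^ 2) ^ 2 * Λ ^ 2 := by
      rw [h1]
      exact mul_le_mul_of_nonneg_left hyle (sq_nonneg _)
    have h5 : c / Λ ^ 2 * c ≤ s * ∫ ω, v ω * y ω ∂μ := by
      rw [h2]
      exact mul_le_mul_of_nonneg_left h (by positivity)
    have h6 : (c / Λ ^ 2) ^ 2 * Λ ^ 2 = c ^ 2 / Λ ^ 2 := by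
      field_simp
    have h7 : c / Λ ^ 2 * c = c ^ 2 / Λ ^ 2 := by ring
    linarith
  rcases abs_cases (∫ ω, v ω * y ω ∂μ) with ⟨h1, _⟩ | ⟨h1, _⟩
  · exact hs (c / Λ ^ 2) rfl (by rw [h1])
  · exact hs (-(c / Λ ^ 2)) (by ring) (by rw [h1]; ring)

/-- Bounded functions whose pairings are close to `u` above the diagonal and close to `d` below
it form only a short sequence. -/
theorem mul_sq_le_of_separated_pairings {Ω : Type*} [MeasurableSpace Ω] {μ : Measure Ω}
    [IsProbabilityMeasure μ] {x y : ℕ → Ω → ℝ} {Λ r c u d : ℝ} (D : ℕ)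
    (hx : ∀ i, Measurable (x i)) (hy : ∀ i, Measurable (y i))
    (hxΛ : ∀ i ω, |x i ω| ≤ Λ) (hyΛ : ∀ i ω, |y i ω| ≤ Λ) (hΛ : 0 < Λ) (hc : 0 < c)
    (hu : ∀ i j, i ≤ j → j < 2 ^ D → |(∫ ω, x i ω * y j ω ∂μ) - u| ≤ r)
    (hd : ∀ i j, j < i → i < 2 ^ D → |(∫ ω, x i ω * y j ω ∂μ) - d| ≤ r)
    (hud : 2 * r + c ≤ |u - d|) : D * c ^ 2 ≤ 4 * Λ ^ 4 := by
  have energy : ∀ t j, j + 2 ^ t ≤ 2 ^ D →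
      (∫ ω, dyadicAvg x t j ω * dyadicAvg x t j ω ∂μ) ≤
        Λ ^ 2 - t * (c ^ 2 / (4 * Λ ^ 2)) := by
    intro t
    induction t with
    | zero =>
      intro j _
      calc (∫ ω, dyadicAvg x 0 j ω * dyadicAvg x 0 j ω ∂μ) ≤ ∫ _, Λ ^ 2 ∂μ := by
            refine integral_mono (integrable_mul_of_abs_le (hx j) (hx j) (hxΛ j) (hxΛ j))
              (integrable_const _) fun ω => ?_
            have := abs_le.1 (hxΛ j ω)
            simp only [dyadicAvg]
            nlinarith
        _ = Λ ^ 2 - (0 : ℕ) * (c ^ 2 / (4 * Λ ^ 2)) := by simp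
    | succ t ih =>
      intro j hj
      have hpow : 2 ^ (t + 1) = 2 ^ t + 2 ^ t := by ring
      have hpos : 0 < 2 ^ t := by positivity
      set a := dyadicAvg x t j with ha
      set b := dyadicAvg x t (j + 2 ^ t) with hb
      have ham : Measurable a := measurable_dyadicAvg hx t j
      have hbm : Measurable b := measurable_dyadicAvg hx t _
      have haΛ : ∀ ω, |a ω| ≤ Λ := abs_dyadicAvg_le hxΛ t j
      have hbΛ : ∀ ω, |b ω| ≤ Λ := abs_dyadicAvg_le hxΛ t _
      have h1 := ih j (by omega)
      have h2 := ih (j + 2 ^ t) (by omega)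
      set q := j + 2 ^ t - 1 with hq
      have h3 : |(∫ ω, a ω * y q ω ∂μ) - u| ≤ r :=
        abs_integral_dyadicAvg_mul_sub_le hx (hy q) hxΛ (hyΛ q) t j
          fun i hi hi' => hu i q (by omega) (by omega)
      have h4 : |(∫ ω, b ω * y q ω ∂μ) - d| ≤ r :=
        abs_integral_dyadicAvg_mul_sub_le hx (hy q) hxΛ (hyΛ q) t _
          fun i hi hi' => hd i q (by omega) (by omega)
      have hdiff : ∀ ω, |a ω - b ω| ≤ Λ + Λ := fun ω =>
        (abs_sub _ _).trans (add_le_add (haΛ ω) (hbΛ ω))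
      have h5 : c ≤ |∫ ω, (a ω - b ω) * y q ω ∂μ| := by
        have h6 : (∫ ω, (a ω - b ω) * y q ω ∂μ) =
            (∫ ω, a ω * y q ω ∂μ) - ∫ ω, b ω * y q ω ∂μ := by
          rw [← integral_sub (integrable_mul_of_abs_le ham (hy q) haΛ (hyΛ q))
            (integrable_mul_of_abs_le hbm (hy q) hbΛ (hyΛ q))]
          simp only [sub_mul]
        rw [h6]
        rw [abs_le] at h3 h4
        rcases le_abs.1 hud with h7 | h7
        · exact le_abs.2 (Or.inl (by linarith))
        · exact le_abs.2 (Or.inr (by linarith))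
      have h6 := sq_le_integral_sq_mul_sq (v := fun ω => a ω - b ω) (ham.sub hbm) (hy q)
        hdiff (hyΛ q) hΛ hc h5
      have haa := integrable_mul_of_abs_le (μ := μ) ham ham haΛ haΛ
      have hbb := integrable_mul_of_abs_le (μ := μ) hbm hbm hbΛ hbΛ
      have hsum : Integrable (fun ω => (a ω * a ω + b ω * b ω) / 2) μ :=
        (haa.add hbb).div_const 2
      have hdd : Integrable (fun ω => (a ω - b ω) * (a ω - b ω) / 4) μ :=
        (integrable_mul_of_abs_le (ham.sub hbm) (ham.sub hbm) hdiff hdiff).div_const 4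
      have h7 : (∫ ω, dyadicAvg x (t + 1) j ω * dyadicAvg x (t + 1) j ω ∂μ) =
          ((∫ ω, a ω * a ω ∂μ) + ∫ ω, b ω * b ω ∂μ) / 2 -
            (∫ ω, (a ω - b ω) * (a ω - b ω) ∂μ) / 4 := by
        rw [← integral_add haa hbb, ← integral_div, ← integral_div,
          ← integral_sub hsum hdd]
        congr 1
        funext ω
        simp only [dyadicAvg, ← ha, ← hb]
        ring
      have h8 : c ^ 2 / (4 * Λ ^ 2) = c ^ 2 / Λ ^ 2 / 4 := by
        field_simp
      rw [h7]
      rw [h8] at h1 h2 ⊢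
      push_cast
      linarith
  have h1 := energy D 0 (by simp)
  have h2 : 0 ≤ ∫ ω, dyadicAvg x D 0 ω * dyadicAvg x D 0 ω ∂μ :=
    integral_nonneg fun ω => mul_self_nonneg _
  have h3 : D * (c ^ 2 / (4 * Λ ^ 2)) = D * c ^ 2 / (4 * Λ ^ 2) := by ring
  have h4 : D * c ^ 2 / (4 * Λ ^ 2) ≤ Λ ^ 2 := by linarith
  rw [div_le_iff₀ (by positivity)] at h4
  linarith [show Λ ^ 2 * (4 * Λ ^ 2) = 4 * Λ ^ 4 by ring]

/-! ### Rank recursion -/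

theorem exists_rank_succ_le {ρ P : ℕ → ℕ → ℕ} {K L r : ℕ} {R Q H : ℕ → ℕ}
    (hPQ : ∀ b k, P b k ≤ Q b) (hR : Monotone R)
    (hfinal : ∀ b (s : ℕ → ℕ), StrictMono s → K ≤ b → b ≤ s 0 → s (R (s 0)) ≤ L →
      P b (s 0) ≤ P b (s (R (s 0))) →
      ¬ ∀ j < R (s 0), ρ (s (j + 1)) b ≤ ρ (s (j + 1)) (s j))
    (hH : Monotone H) (hHle : ∀ y, y ≤ H y) (hHlt : ∀ y, K ≤ y → y < H y)
    (hr : ∀ x, K ≤ x → H x ≤ L → ∃ s, x < s ∧ s ≤ H x ∧ r ≤ ρ s x)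
    {x : ℕ} (hx : K ≤ x) (hxL : (fun y => H^[R y] y)^[Q x + 1] x ≤ L) :
    ∃ s, x < s ∧ s ≤ (fun y => H^[R y] y)^[Q x + 1] x ∧ r + 1 ≤ ρ s x := by
  classical
  by_contra! hcon
  have hid : (id : ℕ → ℕ) ≤ H := hHle
  set H' : ℕ → ℕ := fun y => H^[R y] y with hH'
  have hH'mono : Monotone H' := fun y z hyz =>
    (Function.monotone_iterate_of_id_le hid (hR hyz) y).trans (hH.iterate _ hyz)
  have hid' : (id : ℕ → ℕ) ≤ H' := fun y => Function.id_le_iterate_of_id_le hid _ y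
  have hnx : ∀ y, ∃ n, y < n ∧ (K ≤ y → n ≤ H y) ∧ (K ≤ y → H y ≤ L → r ≤ ρ n y) := by
    intro y
    by_cases h : K ≤ y ∧ H y ≤ L
    · obtain ⟨n, h1, h2, h3⟩ := hr y h.1 h.2
      exact ⟨n, h1, fun _ => h2, fun _ _ => h3⟩
    · exact ⟨y + 1, Nat.lt_succ_self y, fun hy => hHlt y hy, fun h1 h2 => absurd ⟨h1, h2⟩ h⟩
  choose nx hlt hle hrank using hnx
  set s : ℕ → ℕ := fun j => nx^[j] x with hs
  have hsucc : ∀ j, s (j + 1) = nx (s j) := fun j => Function.iterate_succ_apply' nx j x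
  have hsmono : StrictMono s := strictMono_nat_of_lt_succ fun j => by
    rw [hsucc]; exact hlt _
  have hxs : ∀ j, x ≤ s j := fun j => hsmono.monotone (Nat.zero_le j)
  have hgrow : ∀ j i, s (j + i) ≤ H^[i] (s j) := by
    intro j i
    induction i with
    | zero => exact le_rfl
    | succ i ih =>
      rw [← Nat.add_assoc, hsucc, Function.iterate_succ_apply']
      exact (hle _ (hx.trans (hxs _))).trans (hH ih)
  set J : ℕ → ℕ := fun t => (fun j => j + R (s j))^[t] 0 with hJ
  have hJsucc : ∀ t, J (t + 1) = J t + R (s (J t)) := fun t =>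
    Function.iterate_succ_apply' _ t 0
  have hblock : ∀ t, s (J (t + 1)) ≤ H' (s (J t)) := fun t => by
    rw [hJsucc]; exact hgrow _ _
  have hblocks : ∀ t, s (J t) ≤ H'^[t] x := by
    intro t
    induction t with
    | zero => exact le_rfl
    | succ t ih =>
      rw [Function.iterate_succ_apply']
      exact (hblock t).trans (hH'mono ih)
  obtain ⟨t, htQ, ht⟩ : ∃ t ≤ Q x, P x (s (J t)) ≤ P x (s (J (t + 1))) := by
    by_contra! hdec
    have : ∀ t ≤ Q x + 1, P x (s (J t)) + t ≤ Q x := by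
      intro t
      induction t with
      | zero => exact fun _ => hPQ x _
      | succ t ih =>
        intro ht
        have h1 := hdec t (by omega)
        have h2 := ih (by omega)
        omega
    have := this _ le_rfl
    omega
  have hend : H' (s (J t)) ≤ (H')^[Q x + 1] x := by
    calc H' (s (J t)) ≤ H' (H'^[t] x) := hH'mono (hblocks t)
      _ = H'^[t + 1] x := (Function.iterate_succ_apply' _ _ _).symm
      _ ≤ H'^[Q x + 1] x := Function.monotone_iterate_of_id_le hid' (by omega) x
  refine hfinal x (fun i => s (J t + i)) (fun i j hij => hsmono (by omega)) hx (hxs _)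
    ?_ ?_ ?_
  · simp only [Nat.add_zero]
    rw [← hJsucc]
    exact (hblock t).trans (hend.trans hxL)
  · simp only [Nat.add_zero]
    rw [← hJsucc]
    exact ht
  · intro j hj
    simp only [Nat.add_zero] at hj
    have h1 : s (J t + (j + 1)) ≤ H' (s (J t)) :=
      (hgrow _ _).trans (Function.monotone_iterate_of_id_le hid (Nat.succ_le_of_lt hj) _)
    have h2 : H (s (J t + j)) ≤ H' (s (J t)) := by
      refine (hH (hgrow (J t) j)).trans ?_
      rw [← Function.iterate_succ_apply' H]
      exact Function.monotone_iterate_of_id_le hid (Nat.succ_le_of_lt hj) _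
    have h3 : r ≤ ρ (s (J t + (j + 1))) (s (J t + j)) := by
      rw [← Nat.add_assoc, hsucc]
      exact hrank _ (hx.trans (hxs _)) (h2.trans (hend.trans hxL))
    have h4 := hcon (s (J t + (j + 1))) ((hxs _).trans_lt (hsmono (by omega : J t + j < _)))
      (h1.trans hend)
    exact (Nat.lt_succ_iff.1 h4).trans h3

theorem exists_rank_le_of_fgh_le {ρ P : ℕ → ℕ → ℕ} {K L : ℕ} {R Q : ℕ → ℕ}
    (hPQ : ∀ b k, P b k ≤ Q b) (hR : Monotone R)
    (hfinal : ∀ b (s : ℕ → ℕ), StrictMono s → K ≤ b → b ≤ s 0 → s (R (s 0)) ≤ L →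
      P b (s 0) ≤ P b (s (R (s 0))) →
      ¬ ∀ j < R (s 0), ρ (s (j + 1)) b ≤ ρ (s (j + 1)) (s j))
    (hK : 2 ≤ K) (hRle : ∀ y, K ≤ y → R y ≤ fgh 3 y) (hleR : ∀ y, y ≤ R y)
    (hQ : ∀ x, K ≤ x → 2 * (Q x + 1) ≤ fgh 4 x) (r : ℕ) {x : ℕ} (hx : K ≤ x)
    (hxL : fgh (2 + 3 * r) x ≤ L) :
    ∃ s, x < s ∧ s ≤ fgh (2 + 3 * r) x ∧ r ≤ ρ s x := by
  induction r generalizing x with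
  | zero => exact ⟨x + 1, Nat.lt_succ_self x, lt_fgh _ (by omega), Nat.zero_le _⟩
  | succ r ih =>
    have hnest : (fun y => (fgh (2 + 3 * r))^[R y] y)^[Q x + 1] x ≤ fgh (2 + 3 * r + 3) x :=
      nested_iterate_le_fgh (by omega)
        (fun y hy => (hRle y (hx.trans hy)).trans (fgh_level_mono (by omega) (by omega)))
        (fun y _ => hleR y) ((hQ x hx).trans (fgh_level_mono (by omega) (by omega)))
    obtain ⟨s, h1, h2, h3⟩ := exists_rank_succ_le hPQ hR hfinal (fgh_mono (2 + 3 * r))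
      (le_fgh _) (fun y hy => lt_fgh _ (by omega)) (fun x hx hxL => ih hx hxL) hx
      (hnest.trans hxL)
    exact ⟨s, h1, h2.trans hnest, h3⟩

/-! ### Truncation and the contradiction on a long stable block -/

/-- The function `v` cut off to zero where it exceeds `Λ` in absolute value. -/
noncomputable def cutoff {Ω : Type*} (Λ : ℝ) (v : Ω → ℝ) : Ω → ℝ :=
  Set.indicator {ω | |v ω| ≤ Λ} v

theorem measurable_cutoff {Ω : Type*} [MeasurableSpace Ω] (Λ : ℝ) {v : Ω → ℝ}
    (hv : Measurable v) : Measurable (cutoff Λ v) :=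
  hv.indicator (measurableSet_le hv.abs measurable_const)

theorem abs_cutoff_le {Ω : Type*} {Λ : ℝ} (hΛ : 0 ≤ Λ) (v : Ω → ℝ) (ω : Ω) :
    |cutoff Λ v ω| ≤ Λ := by
  by_cases h : |v ω| ≤ Λ
  · have : cutoff Λ v ω = v ω := Set.indicator_of_mem (s := {ω | |v ω| ≤ Λ}) h v
    rwa [this]
  · have : cutoff Λ v ω = 0 := Set.indicator_of_notMem (s := {ω | |v ω| ≤ Λ}) h v
    rwa [this, abs_zero]

theorem measureReal_lt_abs_le {Ω : Type*} [MeasurableSpace Ω] {μ : Measure Ω}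
    [IsFiniteMeasure μ] {v : Ω → ℝ} {B Λ : ℝ} (hv : Integrable v μ)
    (hvB : (∫ ω, |v ω| ∂μ) ≤ B) (hΛ : 0 < Λ) : μ.real {ω | Λ < |v ω|} ≤ B / Λ := by
  have h1 := mul_meas_ge_le_integral_of_nonneg
    (Eventually.of_forall fun ω => abs_nonneg (v ω)) hv.abs Λ
  have h2 : μ.real {ω | Λ < |v ω|} ≤ μ.real {ω | Λ ≤ |v ω|} :=
    measureReal_mono fun ω (hω : Λ < |v ω|) => hω.le
  rw [le_div_iff₀ hΛ]
  nlinarith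

theorem abs_integral_cutoff_mul_sub_lt {Ω : Type*} [MeasurableSpace Ω] {μ : Measure Ω}
    [IsFiniteMeasure μ] {v w : Ω → ℝ} {B Λ κ : ℝ} (hvm : Measurable v) (hwm : Measurable w)
    (hv : Integrable v μ) (hw : Integrable w μ) (hvw : Integrable (fun ω => v ω * w ω) μ)
    (hvB : (∫ ω, |v ω| ∂μ) ≤ B) (hwB : (∫ ω, |w ω| ∂μ) ≤ B) (hΛ : 0 < Λ)
    (hκ : ∀ τ, MeasurableSet τ → μ.real τ ≤ 2 * B / Λ → (∫ ω in τ, |v ω * w ω| ∂μ) < κ) :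
    |(∫ ω, cutoff Λ v ω * cutoff Λ w ω ∂μ) - ∫ ω, v ω * w ω ∂μ| < κ := by
  set τ : Set Ω := {ω | Λ < |v ω|} ∪ {ω | Λ < |w ω|} with hτ
  have hτm : MeasurableSet τ :=
    (measurableSet_lt measurable_const hvm.abs).union (measurableSet_lt measurable_const hwm.abs)
  have hτμ : μ.real τ ≤ 2 * B / Λ := by
    refine (measureReal_union_le _ _).trans ?_
    have h1 := measureReal_lt_abs_le hv hvB hΛ
    have h2 := measureReal_lt_abs_le hw hwB hΛ
    have h3 : 2 * B / Λ = B / Λ + B / Λ := by ring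
    linarith
  have hdiff : ∀ ω, cutoff Λ v ω * cutoff Λ w ω - v ω * w ω =
      τ.indicator (fun ω => -(v ω * w ω)) ω := by
    intro ω
    by_cases h1 : |v ω| ≤ Λ
    · have e1 : cutoff Λ v ω = v ω := Set.indicator_of_mem (s := {ω | |v ω| ≤ Λ}) h1 v
      by_cases h2 : |w ω| ≤ Λ
      · have e2 : cutoff Λ w ω = w ω := Set.indicator_of_mem (s := {ω | |w ω| ≤ Λ}) h2 w
        have h3 : ω ∉ τ := by
          rintro (h | h)
          · exact absurd h1 (not_le.2 h)
          · exact absurd h2 (not_le.2 h)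
        rw [e1, e2, Set.indicator_of_notMem h3, sub_self]
      · have e2 : cutoff Λ w ω = 0 := Set.indicator_of_notMem (s := {ω | |w ω| ≤ Λ}) h2 w
        have h3 : ω ∈ τ := Or.inr (not_le.1 h2)
        rw [e2, Set.indicator_of_mem h3, mul_zero, zero_sub]
    · have e1 : cutoff Λ v ω = 0 := Set.indicator_of_notMem (s := {ω | |v ω| ≤ Λ}) h1 v
      have h3 : ω ∈ τ := Or.inl (not_le.1 h1)
      rw [e1, Set.indicator_of_mem h3, zero_mul, zero_sub]
  have hcut : Integrable (fun ω => cutoff Λ v ω * cutoff Λ w ω) μ :=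
    integrable_mul_of_abs_le (measurable_cutoff Λ hvm) (measurable_cutoff Λ hwm)
      (abs_cutoff_le hΛ.le v) (abs_cutoff_le hΛ.le w)
  rw [← integral_sub hcut hvw]
  simp only [hdiff]
  rw [integral_indicator hτm, integral_neg, abs_neg]
  exact abs_integral_le_integral_abs.trans_lt (hκ τ hτm hτμ)

/-- Stable ranks over a pair of nested windows propagate absolute continuity and pin the value
of the pairing. -/
theorem pairing_control {Ω : Type*} [MeasurableSpace Ω] {μ : Measure Ω}
    [IsProbabilityMeasure μ] {f g : ℕ → Ω → ℝ} {B : ℝ} {Φ : ℝ → ℕ} {θ₁ θ₂ : ℝ} (hB : 1 ≤ B)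
    (hf : ∀ n, Measurable (f n)) (hg : ∀ p, Measurable (g p))
    (hfB : ∀ n ω, |f n ω| ≤ B * 2 ^ n) (hgB : ∀ p ω, |g p ω| ≤ B * 2 ^ p)
    (hfl_p : ∀ n σ, MeasurableSet σ →
      HasBddFluct (fun p => ∫ ω in σ, f n ω * g p ω ∂μ) Φ)
    (hfl_n : ∀ p σ, MeasurableSet σ →
      HasBddFluct (fun n => ∫ ω in σ, f n ω * g p ω ∂μ) Φ)
    (hθ₁ : 0 < θ₁) (hθ₂ : 16 * θ₂ = θ₁ / (2 * (Φ θ₁ + 1))) {b k c p q : ℕ} (hbk : b ≤ k)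
    (hkp : k < p) (hpc : p ≤ c)
    (h1 : ∀ i ≤ b, fluctRank μ θ₂ (Φ θ₂) (fun p ω => f i ω * g p ω) k ≤
      fluctRank μ θ₂ (Φ θ₂) (fun p ω => f i ω * g p ω) c)
    (h2 : fluctRank μ θ₁ (Φ θ₁) (fun n ω => f n ω * g p ω) b ≤
      fluctRank μ θ₁ (Φ θ₁) (fun n ω => f n ω * g p ω) q) :
    ∀ n, b < n → n ≤ q →
      (∀ τ, MeasurableSet τ → μ.real τ * (B ^ 2 * 4 ^ k) < θ₂ / (2 * (Φ θ₂ + 1)) →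
        (∫ ω in τ, |f n ω * g p ω| ∂μ) < 16 * θ₁) ∧
      |(∫ ω, f n ω * g p ω ∂μ) - ∫ ω, f b ω * g c ω ∂μ| < 2 * θ₁ := by
  have hθ₂pos : 0 < θ₂ := by
    have : 0 < θ₁ / (2 * (Φ θ₁ + 1)) := by positivity
    linarith
  have hθ₂le : 16 * θ₂ ≤ θ₁ := by
    rw [hθ₂]
    refine div_le_self hθ₁.le ?_
    have : (0 : ℝ) ≤ Φ θ₁ := Nat.cast_nonneg _
    linarith
  have hm : ∀ n p, Measurable fun ω => f n ω * g p ω := fun n p => (hf n).mul (hg p)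
  have hi : ∀ n p, Integrable (fun ω => f n ω * g p ω) μ := fun n p =>
    integrable_mul_of_abs_le (hf n) (hg p) (hfB n) (hgB p)
  intro n hbn hnq
  obtain ⟨hosc₁, hesc₁⟩ := fluctRank_stable (fun n => hm n p) (fun n => hi n p) (hfl_n p) hθ₁ h2
  have hstab := fun i (hib : i ≤ b) =>
    fluctRank_stable (fun p => hm i p) (fun p => hi i p) (hfl_p i) hθ₂pos (h1 i hib)
  constructor
  · intro τ hτ hμτ
    refine hesc₁ n hbn hnq τ hτ fun i hib => ?_
    rw [← hθ₂]
    refine (hstab i hib).2 p hkp hpc τ hτ fun l hlk => ?_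
    have hpt : ∀ ω ∈ τ, ‖|f i ω * g l ω|‖ ≤ B ^ 2 * 4 ^ k := by
      intro ω _
      rw [Real.norm_eq_abs, abs_abs, abs_mul]
      have h3 : (2 : ℝ) ^ i ≤ 2 ^ k := pow_le_pow_right₀ one_le_two (hib.trans hbk)
      have h4 : (2 : ℝ) ^ l ≤ 2 ^ k := pow_le_pow_right₀ one_le_two hlk
      calc |f i ω| * |g l ω| ≤ (B * 2 ^ k) * (B * 2 ^ k) := by
            refine mul_le_mul ((hfB i ω).trans ?_) ((hgB l ω).trans ?_) (abs_nonneg _)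
              (by positivity)
            · gcongr
            · gcongr
        _ = B ^ 2 * 4 ^ k := by
            rw [show (4 : ℝ) = 2 * 2 by norm_num, mul_pow]
            ring
    have h5 := norm_setIntegral_le_of_norm_le_const (measure_lt_top μ τ) hpt
    rw [Real.norm_eq_abs] at h5
    exact (le_abs_self _).trans_lt (h5.trans_lt (by rwa [mul_comm]))
  · have h3 := abs_lt.1 (hosc₁ n hbn.le hnq)
    have h4 := abs_lt.1 ((hstab b le_rfl).1 p hkp.le hpc)
    have h5 := abs_lt.1 ((hstab b le_rfl).1 c (hkp.le.trans hpc) le_rfl)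
    exact abs_lt.2 ⟨by linarith, by linarith⟩

/-- The rank of the row and of the column through `s`. -/
noncomputable def crossRank {Ω : Type*} [MeasurableSpace Ω] (μ : Measure Ω) (θ : ℝ) (F : ℕ)
    (f g : ℕ → Ω → ℝ) (s b : ℕ) : ℕ :=
  fluctRank μ θ F (fun n ω => f n ω * g s ω) b + fluctRank μ θ F (fun p ω => f s ω * g p ω) b

theorem crossRank_le {Ω : Type*} [MeasurableSpace Ω] (μ : Measure Ω) (θ : ℝ) (F : ℕ)
    (f g : ℕ → Ω → ℝ) (s b : ℕ) : crossRank μ θ F f g s b ≤ 4 * F := by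
  have h1 := fluctRank_le μ θ F (fun n ω => f n ω * g s ω) b
  have h2 := fluctRank_le μ θ F (fun p ω => f s ω * g p ω) b
  unfold crossRank
  omega

theorem crossRank_anti {Ω : Type*} [MeasurableSpace Ω] (μ : Measure Ω) (θ : ℝ) (F : ℕ)
    (f g : ℕ → Ω → ℝ) (s : ℕ) : Antitone (crossRank μ θ F f g s) := fun _ _ hb =>
  Nat.add_le_add (fluctRank_anti _ _ _ _ hb) (fluctRank_anti _ _ _ _ hb)

theorem crossRank_stable {Ω : Type*} [MeasurableSpace Ω] {μ : Measure Ω} {θ : ℝ} {F : ℕ}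
    {f g : ℕ → Ω → ℝ} {s b c : ℕ} (hbc : b ≤ c)
    (h : crossRank μ θ F f g s b ≤ crossRank μ θ F f g s c) :
    fluctRank μ θ F (fun n ω => f n ω * g s ω) b ≤
        fluctRank μ θ F (fun n ω => f n ω * g s ω) c ∧
      fluctRank μ θ F (fun p ω => f s ω * g p ω) b ≤
        fluctRank μ θ F (fun p ω => f s ω * g p ω) c := by
  have h1 := fluctRank_anti μ θ F (fun n ω => f n ω * g s ω) hbc
  have h2 := fluctRank_anti μ θ F (fun p ω => f s ω * g p ω) hbc
  unfold crossRank at h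
  omega

theorem not_stable_block {Ω : Type*} [MeasurableSpace Ω] {μ : Measure Ω}
    [IsProbabilityMeasure μ] {f g : ℕ → Ω → ℝ} {B : ℝ} {Φ : ℝ → ℕ} {ε θ₁ θ₂ : ℝ} (hB : 1 ≤ B)
    (hf : ∀ n, Measurable (f n)) (hg : ∀ p, Measurable (g p))
    (hfB : ∀ n ω, |f n ω| ≤ B * 2 ^ n) (hgB : ∀ p ω, |g p ω| ≤ B * 2 ^ p)
    (hf_norm : ∀ n, (∫ ω, |f n ω| ∂μ) ≤ B) (hg_norm : ∀ p, (∫ ω, |g p ω| ∂μ) ≤ B)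
    (hfl_p : ∀ n σ, MeasurableSet σ →
      HasBddFluct (fun p => ∫ ω in σ, f n ω * g p ω ∂μ) Φ)
    (hfl_n : ∀ p σ, MeasurableSet σ →
      HasBddFluct (fun n => ∫ ω in σ, f n ω * g p ω ∂μ) Φ)
    (hε : 0 < ε) (hθ₁ : 4 * θ₁ = ε) (hθ₂ : 16 * θ₂ = θ₁ / (2 * (Φ θ₁ + 1))) {L : ℕ}
    (hsep : ∀ m s l q, m < s → q < l → s ≤ L → l ≤ L →
      20 * ε ≤ |(∫ ω, f m ω * g s ω ∂μ) - ∫ ω, f l ω * g q ω ∂μ|)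
    {b D : ℕ} {s : ℕ → ℕ} (hs : StrictMono s) (hbs : b ≤ s 0)
    (hD : 4 * (3 * B * (B ^ 2 * 4 ^ s 0) / (θ₂ / (2 * (Φ θ₂ + 1)))) ^ 4 < D * ε ^ 2)
    (hsL : s (2 ^ (D + 1)) ≤ L)
    (hP : ∑ i ∈ Finset.range (b + 1), crossRank μ θ₂ (Φ θ₂) f g i (s 0) ≤
      ∑ i ∈ Finset.range (b + 1), crossRank μ θ₂ (Φ θ₂) f g i (s (2 ^ (D + 1)))) :
    ¬ ∀ j < 2 ^ (D + 1), crossRank μ θ₁ (Φ θ₁) f g (s (j + 1)) b ≤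
      crossRank μ θ₁ (Φ θ₁) f g (s (j + 1)) (s j) := by
  intro hρ
  set N := 2 ^ (D + 1) with hN
  have hNpos : 0 < N := by positivity
  set k := s 0 with hk
  set c := s N with hc
  have hkc : k ≤ c := hs.monotone (Nat.zero_le N)
  have hbc : b < c := hbs.trans_lt (hs hNpos)
  have hθ₁pos : 0 < θ₁ := by linarith
  have hθ₂pos : 0 < θ₂ := by
    have : 0 < θ₁ / (2 * (Φ θ₁ + 1)) := by positivity
    linarith
  set η := θ₂ / (2 * (Φ θ₂ + 1)) with hη
  have hηpos : 0 < η := by positivity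
  set W := B ^ 2 * 4 ^ k with hW
  have hB0 : 0 < B := by linarith
  have hWpos : 0 < W := by positivity
  set Λ := 3 * B * W / η with hΛ
  have hΛpos : 0 < Λ := by positivity
  have hrow : ∀ i ≤ b, crossRank μ θ₂ (Φ θ₂) f g i k ≤ crossRank μ θ₂ (Φ θ₂) f g i c := by
    have hle : ∀ i ∈ Finset.range (b + 1),
        crossRank μ θ₂ (Φ θ₂) f g i c ≤ crossRank μ θ₂ (Φ θ₂) f g i k :=
      fun i _ => crossRank_anti μ θ₂ (Φ θ₂) f g i hkc
    have heq := (Finset.sum_eq_sum_iff_of_le hle).1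
      (le_antisymm (Finset.sum_le_sum hle) hP)
    exact fun i hi => (heq i (Finset.mem_range.2 (Nat.lt_succ_of_le hi))).ge
  have hlow : ∀ i j, 1 ≤ i → i < j → j ≤ N →
      (∀ τ, MeasurableSet τ → μ.real τ * W < η →
        (∫ ω in τ, |f (s i) ω * g (s j) ω| ∂μ) < 16 * θ₁) ∧
      |(∫ ω, f (s i) ω * g (s j) ω ∂μ) - ∫ ω, f b ω * g c ω ∂μ| < 2 * θ₁ := by
    intro i j hi hij hj
    obtain ⟨j, rfl⟩ : ∃ j', j = j' + 1 := ⟨j - 1, by omega⟩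
    exact pairing_control hB hf hg hfB hgB hfl_p hfl_n hθ₁pos hθ₂ hbs
      (hs (Nat.succ_pos j)) (hs.monotone hj)
      (fun l hl => (crossRank_stable hkc (hrow l hl)).2)
      (crossRank_stable (hbs.trans (hs.monotone (Nat.zero_le j))) (hρ j hj)).1
      (s i) (hbs.trans_lt (hs hi)) (hs.monotone (Nat.lt_succ_iff.1 hij))
  have hupp : ∀ i j, 1 ≤ j → j < i → i ≤ N →
      (∀ τ, MeasurableSet τ → μ.real τ * W < η →
        (∫ ω in τ, |f (s i) ω * g (s j) ω| ∂μ) < 16 * θ₁) ∧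
      |(∫ ω, f (s i) ω * g (s j) ω ∂μ) - ∫ ω, f c ω * g b ω ∂μ| < 2 * θ₁ := by
    intro i j hj hij hi
    obtain ⟨i, rfl⟩ : ∃ i', i = i' + 1 := ⟨i - 1, by omega⟩
    have h := pairing_control (μ := μ) (f := g) (g := f) (Φ := Φ) (c := c)
      (p := s (i + 1)) hB hg hf hgB hfB
      (fun p σ hσ => by simpa only [mul_comm] using hfl_n p σ hσ)
      (fun n σ hσ => by simpa only [mul_comm] using hfl_p n σ hσ) hθ₁pos hθ₂ hbs
      (hs (Nat.succ_pos i)) (hs.monotone hi)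
      (fun l hl => by
        have := (crossRank_stable hkc (hrow l hl)).1
        simpa only [mul_comm (g _ _) (f _ _)] using this)
      (by
        have := (crossRank_stable (hbs.trans (hs.monotone (Nat.zero_le i))) (hρ i hi)).2
        simpa only [mul_comm (g _ _) (f _ _)] using this)
      (s j) (hbs.trans_lt (hs hj)) (hs.monotone (Nat.lt_succ_iff.1 hij))
    simp only [mul_comm (g _ _) (f _ _)] at h
    exact h
  have hfi : ∀ n, Integrable (f n) μ := fun n =>
    Integrable.of_bound (hf n).aestronglyMeasurable _ (Eventually.of_forall (hfB n))
  have hgi : ∀ p, Integrable (g p) μ := fun p =>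
    Integrable.of_bound (hg p).aestronglyMeasurable _ (Eventually.of_forall (hgB p))
  have hcut : ∀ i j v, (∀ τ, MeasurableSet τ → μ.real τ * W < η →
        (∫ ω in τ, |f i ω * g j ω| ∂μ) < 16 * θ₁) ∧
      |(∫ ω, f i ω * g j ω ∂μ) - v| < 2 * θ₁ →
      |(∫ ω, cutoff Λ (f i) ω * cutoff Λ (g j) ω ∂μ) - v| ≤ 9 / 2 * ε := by
    rintro i j v ⟨h1, h2⟩
    have h3 := abs_integral_cutoff_mul_sub_lt (hf i) (hg j) (hfi i) (hgi j)
      (integrable_mul_of_abs_le (hf i) (hg j) (hfB i) (hgB j)) (hf_norm i) (hg_norm j) hΛpos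
      (fun τ hτ hμτ => h1 τ hτ (by
        have h4 : 2 * B / Λ * W = 2 / 3 * η := by
          rw [hΛ]
          field_simp
        have h5 := mul_le_mul_of_nonneg_right hμτ hWpos.le
        linarith))
    rw [abs_lt] at h2 h3
    exact abs_le.2 ⟨by linarith, by linarith⟩
  have hpow : N = 2 * 2 ^ D := by rw [hN]; ring
  have h1 := mul_sq_le_of_separated_pairings (μ := μ) (x := fun i => cutoff Λ (f (s (2 * i + 1))))
    (y := fun j => cutoff Λ (g (s (2 * j + 2)))) (Λ := Λ) (r := 9 / 2 * ε) (c := ε) D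
    (fun i => measurable_cutoff Λ (hf _)) (fun j => measurable_cutoff Λ (hg _))
    (fun i => abs_cutoff_le hΛpos.le _) (fun j => abs_cutoff_le hΛpos.le _) hΛpos hε
    (fun i j hij hj => hcut _ _ _ (hlow _ _ (by omega) (by omega) (by omega)))
    (fun i j hij hi => hcut _ _ _ (hupp _ _ (by omega) (by omega) (by omega)))
    (by linarith [hsep b c c b hbc hbc hsL hsL])
  linarith

/-! ### Numerical estimates -/

theorem tower_le_fgh_three {y : ℕ} (hy : 5 ≤ y) : 2 ^ (2 ^ (25 * y) + 1) ≤ fgh 3 y := by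
  have h1 : 25 * y ≤ fgh 2 y := by
    rw [fgh_two]
    refine Nat.mul_le_mul_right y ?_
    calc 25 ≤ 2 ^ 5 := by norm_num
      _ ≤ 2 ^ y := Nat.pow_le_pow_right two_pos hy
  have h2 : 2 ^ (25 * y) + 1 ≤ fgh 2 (25 * y) := by
    rw [fgh_two]
    have h3 : 1 ≤ 2 ^ (25 * y) := Nat.one_le_two_pow
    nlinarith
  calc 2 ^ (2 ^ (25 * y) + 1) ≤ fgh 2 (2 ^ (25 * y) + 1) := two_pow_le_fgh_two (Nat.succ_pos _)
    _ ≤ fgh 2 (fgh 2 (25 * y)) := fgh_mono 2 h2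
    _ ≤ fgh 2 (fgh 2 (fgh 2 y)) := fgh_mono 2 (fgh_mono 2 h1)
    _ ≤ fgh 3 y := three_fold_fgh_two_le (by omega)

theorem le_two_pow_tower (y : ℕ) : y ≤ 2 ^ (2 ^ (25 * y) + 1) := by
  have h1 : 25 * y < 2 ^ (25 * y) := Nat.lt_two_pow_self
  have h2 : 2 ^ (25 * y) + 1 < 2 ^ (2 ^ (25 * y) + 1) := Nat.lt_two_pow_self
  omega

theorem cubic_le_fgh_four {x F : ℕ} (hx : 5 ≤ x) (hF : F ≤ x ^ 2) :
    2 * ((x + 1) * (4 * F) + 1) ≤ fgh 4 x := by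
  have h1 : 2 * ((x + 1) * (4 * F) + 1) ≤ 2 ^ (25 * x) := by
    have h2 : x ≤ 2 ^ x := Nat.lt_two_pow_self.le
    calc 2 * ((x + 1) * (4 * F) + 1) ≤ 2 * ((x + 1) * (4 * x ^ 2) + 1) := by gcongr
      _ ≤ 2 ^ 5 * x ^ 3 := by nlinarith [Nat.pow_le_pow_left hx 2, Nat.pow_le_pow_left hx 3]
      _ ≤ 2 ^ x * (2 ^ x) ^ 3 := by gcongr; norm_num
      _ = 2 ^ (4 * x) := by ring
      _ ≤ 2 ^ (25 * x) := Nat.pow_le_pow_right two_pos (by omega)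
  have h3 : 2 ^ (25 * x) < 2 ^ (2 ^ (25 * x)) := Nat.lt_two_pow_self
  have h4 : 2 ^ (2 ^ (25 * x)) ≤ 2 ^ (2 ^ (25 * x) + 1) :=
    Nat.pow_le_pow_right two_pos (Nat.le_succ _)
  exact h1.trans (h3.le.trans (h4.trans ((tower_le_fgh_three hx).trans
    (fgh_le_fgh_succ 3 (by omega)))))

theorem fluct_bound_estimates {B ε θ₁ θ₂ : ℝ} {F₁ F₂ K : ℕ} (hB : 1 ≤ B) (hε : 0 < ε)
    (hθ₁ : 4 * θ₁ = ε) (hF₁ : F₁ = ⌈8 * B ^ 2 * (⌈1 / θ₁⌉₊ : ℝ) ^ 2⌉₊)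
    (hθ₂ : 16 * θ₂ = θ₁ / (2 * (F₁ + 1))) (hF₂ : F₂ = ⌈8 * B ^ 2 * (⌈1 / θ₂⌉₊ : ℝ) ^ 2⌉₊)
    (hK : K = ⌈2 ^ 22 * B ^ 4 * (⌈1 / ε⌉₊ : ℝ) ^ 4⌉₊ + 5) :
    12 * F₁ + 5 ≤ K ∧ F₂ ≤ K ^ 2 ∧ ∀ k, K ≤ k →
      4 * (3 * B * (B ^ 2 * 4 ^ k) / (θ₂ / (2 * (F₂ + 1)))) ^ 4 <
        ((2 ^ (25 * k) : ℕ) : ℝ) * ε ^ 2 := by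
  set E := ⌈1 / ε⌉₊ with hE
  have hεE : 1 / ε ≤ E := Nat.le_ceil _
  have hE1 : (1 : ℝ) ≤ E := by
    exact_mod_cast Nat.one_le_ceil_iff.2 (by positivity)
  obtain ⟨A, hA⟩ : ∃ A : ℝ, A = B * E := ⟨_, rfl⟩
  have hA1 : 1 ≤ A := by rw [hA]; nlinarith
  have hBA : B ≤ A := by rw [hA]; nlinarith
  have hEA : (E : ℝ) ≤ A := by rw [hA]; nlinarith
  have hKA : 2 ^ 22 * A ^ 4 + 5 ≤ K := by
    rw [hK, hA]
    push_cast
    have := Nat.le_ceil (2 ^ 22 * B ^ 4 * (E : ℝ) ^ 4)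
    rw [mul_pow]
    linarith
  have hA2 : 1 ≤ A ^ 2 := one_le_pow₀ hA1
  have hA3 : 1 ≤ A ^ 3 := one_le_pow₀ hA1
  have hA24 : A ^ 2 ≤ A ^ 4 := pow_le_pow_right₀ hA1 (by norm_num)
  have hθ₁pos : 0 < θ₁ := by linarith
  have hinvθ₁ : 1 / θ₁ ≤ 4 * E := by
    have : 1 / θ₁ = 4 * (1 / ε) := by rw [← hθ₁]; field_simp
    linarith
  have hF₁A : (F₁ : ℝ) ≤ 129 * A ^ 2 := by
    have h1 : (⌈1 / θ₁⌉₊ : ℝ) ≤ 4 * E := by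
      have : ⌈1 / θ₁⌉₊ ≤ 4 * E := Nat.ceil_le.2 (by push_cast; exact hinvθ₁)
      exact_mod_cast this
    have h2 : (F₁ : ℝ) < 8 * B ^ 2 * (⌈1 / θ₁⌉₊ : ℝ) ^ 2 + 1 := by
      rw [hF₁]; exact Nat.ceil_lt_add_one (by positivity)
    have h3 : 8 * B ^ 2 * (⌈1 / θ₁⌉₊ : ℝ) ^ 2 ≤ 8 * B ^ 2 * (4 * E) ^ 2 := by gcongr
    have h4 : 8 * B ^ 2 * (4 * (E : ℝ)) ^ 2 = 128 * A ^ 2 := by rw [hA]; ring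
    linarith
  have hθ₂pos : 0 < θ₂ := by
    have : 0 < θ₁ / (2 * (F₁ + 1)) := by positivity
    linarith
  have hinvθ₂ : 1 / θ₂ ≤ 16640 * A ^ 3 := by
    have h1 : 1 / θ₂ = 32 * (F₁ + 1) * (1 / θ₁) := by
      have h2 : θ₂ = θ₁ / (2 * (F₁ + 1)) / 16 := by linarith
      rw [h2]
      field_simp
      ring
    rw [h1]
    calc 32 * ((F₁ : ℝ) + 1) * (1 / θ₁) ≤ 32 * (130 * A ^ 2) * (4 * A) := by
          gcongr
          · linarith
          · linarith
      _ = 16640 * A ^ 3 := by ring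
  have hF₂A : (F₂ : ℝ) + 1 ≤ 2 ^ 34 * A ^ 8 := by
    have h1 : (⌈1 / θ₂⌉₊ : ℝ) ≤ 2 ^ 15 * A ^ 3 := by
      have := Nat.ceil_lt_add_one (a := 1 / θ₂) (by positivity)
      linarith
    have h2 : (F₂ : ℝ) < 8 * B ^ 2 * (⌈1 / θ₂⌉₊ : ℝ) ^ 2 + 1 := by
      rw [hF₂]; exact Nat.ceil_lt_add_one (by positivity)
    have h3 : 8 * B ^ 2 * (⌈1 / θ₂⌉₊ : ℝ) ^ 2 ≤ 8 * A ^ 2 * (2 ^ 15 * A ^ 3) ^ 2 := by gcongr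
    have h4 : 8 * A ^ 2 * (2 ^ 15 * A ^ 3) ^ 2 = 2 ^ 33 * A ^ 8 := by ring
    have h5 : 1 ≤ A ^ 8 := one_le_pow₀ hA1
    linarith
  have hKA' : 2 ^ 22 * A ^ 4 ≤ K := by linarith
  refine ⟨?_, ?_, fun k hk => ?_⟩
  · have : (12 * F₁ + 5 : ℝ) ≤ K := by linarith
    exact_mod_cast this
  · have h1 : (2 ^ 22 * A ^ 4) ^ 2 ≤ (K : ℝ) ^ 2 := by gcongr
    have h2 : (2 ^ 22 * A ^ 4) ^ 2 = 2 ^ 44 * A ^ 8 := by ring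
    have h5 : 1 ≤ A ^ 8 := one_le_pow₀ hA1
    have : (F₂ : ℝ) ≤ (K : ℝ) ^ 2 := by linarith
    exact_mod_cast this
  · have hkA : 2 ^ 22 * A ^ 4 ≤ (k : ℝ) := hKA'.trans (by exact_mod_cast hk)
    have hkpow : (k : ℝ) ≤ 2 ^ k := by exact_mod_cast (Nat.lt_two_pow_self (n := k)).le
    have hinvη : 1 / (θ₂ / (2 * (F₂ + 1))) ≤ (k : ℝ) ^ 3 := by
      have h1 : 1 / (θ₂ / (2 * ((F₂ : ℝ) + 1))) = 2 * (F₂ + 1) * (1 / θ₂) := by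
        field_simp
      have h2 : (2 ^ 22 * A ^ 4) ^ 3 ≤ (k : ℝ) ^ 3 := by gcongr
      rw [h1]
      calc 2 * ((F₂ : ℝ) + 1) * (1 / θ₂) ≤ 2 * (2 ^ 34 * A ^ 8) * (16640 * A ^ 3) := by gcongr
        _ = 2 ^ 35 * 16640 * A ^ 11 := by ring
        _ ≤ 2 ^ 66 * A ^ 12 := by
          have h3 : A ^ 11 ≤ A ^ 12 := pow_le_pow_right₀ hA1 (by norm_num)
          have h4 : 0 ≤ A ^ 12 := by positivity
          nlinarith
        _ = (2 ^ 22 * A ^ 4) ^ 3 := by ring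
        _ ≤ (k : ℝ) ^ 3 := h2
    have hΛ : 3 * B * (B ^ 2 * 4 ^ k) / (θ₂ / (2 * (F₂ + 1))) ≤ (2 : ℝ) ^ (6 * k) := by
      have h1 : 3 * B * (B ^ 2 * 4 ^ k) / (θ₂ / (2 * ((F₂ : ℝ) + 1))) =
          3 * B ^ 3 * 4 ^ k * (1 / (θ₂ / (2 * (F₂ + 1)))) := by ring
      have h2 : 3 * B ^ 3 ≤ (k : ℝ) := by
        have h3 : B ^ 3 ≤ A ^ 3 := by gcongr
        have h4 : A ^ 3 ≤ A ^ 4 := pow_le_pow_right₀ hA1 (by norm_num)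
        linarith
      rw [h1]
      calc 3 * B ^ 3 * 4 ^ k * (1 / (θ₂ / (2 * ((F₂ : ℝ) + 1))))
          ≤ 2 ^ k * 4 ^ k * (2 ^ k) ^ 3 := by
            refine mul_le_mul ?_ (hinvη.trans ?_) (by positivity) (by positivity)
            · exact mul_le_mul_of_nonneg_right (h2.trans hkpow) (by positivity)
            · gcongr
        _ = 2 ^ (6 * k) := by
          rw [show (4 : ℝ) = 2 ^ 2 by norm_num, ← pow_mul, ← pow_mul, ← pow_add, ← pow_add]
          congr 1
          ring
    have hεA : 1 ≤ A ^ 2 * ε ^ 2 := by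
      have h1 : 1 ≤ A * ε := by
        rw [← div_le_iff₀ hε]
        exact hεE.trans hEA
      rw [← mul_pow]
      exact one_le_pow₀ h1
    push_cast
    calc 4 * (3 * B * (B ^ 2 * 4 ^ k) / (θ₂ / (2 * ((F₂ : ℝ) + 1)))) ^ 4
        ≤ 4 * ((2 : ℝ) ^ (6 * k)) ^ 4 := by gcongr
      _ ≤ 4 * ((2 : ℝ) ^ (6 * k)) ^ 4 * (A ^ 2 * ε ^ 2) :=
        le_mul_of_one_le_right (by positivity) hεA
      _ = 4 * A ^ 2 * ((2 : ℝ) ^ (6 * k)) ^ 4 * ε ^ 2 := by ring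
      _ < 2 ^ k * ((2 : ℝ) ^ (6 * k)) ^ 4 * ε ^ 2 := by
        have h1 : 4 * A ^ 2 < (2 : ℝ) ^ k := by linarith
        gcongr
      _ = 2 ^ (25 * k) * ε ^ 2 := by ring

/-! ### Reduction to bounded functions -/

theorem exists_pairing_close_of_bounded {Ω : Type*} [MeasurableSpace Ω] {μ : Measure Ω}
    [IsProbabilityMeasure μ] {f g : ℕ → Ω → ℝ} {B : ℝ} (hB : 1 ≤ B)
    (hf : ∀ n, Measurable (f n)) (hg : ∀ p, Measurable (g p))
    (hfB : ∀ n ω, |f n ω| ≤ B * 2 ^ n) (hgB : ∀ p ω, |g p ω| ≤ B * 2 ^ p)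
    (hf_norm : ∀ n, (∫ ω, |f n ω| ∂μ) ≤ B) (hg_norm : ∀ p, (∫ ω, |g p ω| ∂μ) ≤ B)
    (hfl_p : ∀ n σ, MeasurableSet σ →
      HasBddFluct (fun p => ∫ ω in σ, f n ω * g p ω ∂μ)
        (fun ε => ⌈8 * B ^ 2 * (⌈1 / ε⌉₊ : ℝ) ^ 2⌉₊))
    (hfl_n : ∀ p σ, MeasurableSet σ →
      HasBddFluct (fun n => ∫ ω in σ, f n ω * g p ω ∂μ)
        (fun ε => ⌈8 * B ^ 2 * (⌈1 / ε⌉₊ : ℝ) ^ 2⌉₊))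
    {ε : ℝ} (hε : 0 < ε) :
    ∃ m s q l : ℕ, m < s ∧ q < l ∧
      s ≤ fghOmega (⌈2 ^ 22 * B ^ 4 * (⌈1 / ε⌉₊ : ℝ) ^ 4⌉₊ + 5) ∧
      l ≤ fghOmega (⌈2 ^ 22 * B ^ 4 * (⌈1 / ε⌉₊ : ℝ) ^ 4⌉₊ + 5) ∧
      |(∫ ω, f m ω * g s ω ∂μ) - ∫ ω, f l ω * g q ω ∂μ| < 20 * ε := by
  obtain ⟨Φ, hΦ⟩ : ∃ Φ : ℝ → ℕ, Φ = fun ε => ⌈8 * B ^ 2 * (⌈1 / ε⌉₊ : ℝ) ^ 2⌉₊ := ⟨_, rfl⟩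
  obtain ⟨K, hK⟩ : ∃ K : ℕ, K = ⌈2 ^ 22 * B ^ 4 * (⌈1 / ε⌉₊ : ℝ) ^ 4⌉₊ + 5 := ⟨_, rfl⟩
  obtain ⟨θ₁, hθ₁⟩ : ∃ θ₁ : ℝ, 4 * θ₁ = ε := ⟨ε / 4, by ring⟩
  obtain ⟨θ₂, hθ₂⟩ : ∃ θ₂ : ℝ, 16 * θ₂ = θ₁ / (2 * (Φ θ₁ + 1)) :=
    ⟨θ₁ / (2 * (Φ θ₁ + 1)) / 16, by ring⟩
  rw [← hΦ] at hfl_p hfl_n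
  rw [← hK]
  obtain ⟨hF₁, hF₂, hD⟩ := fluct_bound_estimates hB hε hθ₁ (congrFun hΦ θ₁) hθ₂
    (congrFun hΦ θ₂) hK
  by_contra! hcon
  have hsep : ∀ m s l q, m < s → q < l → s ≤ fgh K K → l ≤ fgh K K →
      20 * ε ≤ |(∫ ω, f m ω * g s ω ∂μ) - ∫ ω, f l ω * g q ω ∂μ| :=
    fun m s l q h1 h2 h3 h4 => hcon m s q l h1 h2 h3 h4
  have hK5 : 5 ≤ K := by omega
  obtain ⟨s, _, _, hs⟩ := exists_rank_le_of_fgh_le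
    (ρ := crossRank μ θ₁ (Φ θ₁) f g)
    (P := fun b k => ∑ i ∈ Finset.range (b + 1), crossRank μ θ₂ (Φ θ₂) f g i k)
    (K := K) (L := fgh K K) (R := fun k => 2 ^ (2 ^ (25 * k) + 1))
    (Q := fun b => (b + 1) * (4 * Φ θ₂))
    (fun b k => by
      refine (Finset.sum_le_card_nsmul _ _ _ fun i _ => crossRank_le μ θ₂ (Φ θ₂) f g i k).trans ?_
      rw [Finset.card_range, smul_eq_mul])
    (fun k k' h => by
      have h1 : 2 ^ (25 * k) ≤ 2 ^ (25 * k') := Nat.pow_le_pow_right two_pos (by omega)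
      exact Nat.pow_le_pow_right two_pos (Nat.succ_le_succ h1))
    (fun b s hs hb hbs hsL hP => not_stable_block hB hf hg hfB hgB hf_norm hg_norm hfl_p hfl_n hε
      hθ₁ hθ₂ hsep hs hbs (hD _ (hb.trans hbs)) hsL hP)
    (by omega) (fun y hy => tower_le_fgh_three (hK5.trans hy)) le_two_pow_tower
    (fun x hx => cubic_le_fgh_four (hK5.trans hx) (hF₂.trans (Nat.pow_le_pow_left hx 2)))
    (4 * Φ θ₁ + 1) (le_refl K) (fgh_level_mono (by omega) (by omega))
  have := crossRank_le μ θ₁ (Φ θ₁) f g s K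
  omega

theorem exists_bounded_ae_eq {Ω : Type*} [MeasurableSpace Ω] {μ : Measure Ω}
    [IsFiniteMeasure μ] {v : Ω → ℝ} {C : ℝ} (hC : 0 < C) (hv : Integrable v μ)
    (hac : ∀ ε : ℝ, 0 < ε → ∀ σ : Set Ω, MeasurableSet σ →
      μ σ < ENNReal.ofReal (ε / C) → (∫ x in σ, |v x| ∂μ) < ε) :
    ∃ w : Ω → ℝ, Measurable w ∧ (∀ x, |w x| ≤ C) ∧ w =ᵐ[μ] v := by
  have hle : ∀ σ, MeasurableSet σ → (∫ x in σ, |v x| ∂μ) ≤ C * μ.real σ := by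
    intro σ hσ
    refine le_of_forall_pos_lt_add fun δ hδ => hac _ (by positivity) σ hσ ?_
    rw [← ENNReal.ofReal_toReal (measure_ne_top μ σ),
      ENNReal.ofReal_lt_ofReal_iff (by positivity), lt_div_iff₀ hC]
    have : μ.real σ = (μ σ).toReal := rfl
    rw [← this]
    linarith
  have hae : (fun x => |v x|) ≤ᵐ[μ] fun _ => C := by
    refine ae_le_of_forall_setIntegral_le hv.abs (integrable_const C) fun σ hσ _ => ?_
    rw [setIntegral_const, smul_eq_mul, mul_comm]
    exact hle σ hσ
  obtain ⟨u, hu, huv⟩ := hv.aestronglyMeasurable.aemeasurable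
  refine ⟨fun x => max (-C) (min C (u x)), measurable_const.max (measurable_const.min hu),
    fun x => abs_le.2 ⟨le_max_left _ _, max_le (by linarith) (min_le_left _ _)⟩, ?_⟩
  filter_upwards [hae, huv] with x hx hux
  have := abs_le.1 hx
  rw [← hux, min_eq_right this.2, max_eq_right this.1]

/-- Quantitative exchange of limits under bounded fluctuations and uniform
absolute continuity hypotheses. -/
theorem quantitative_limit_exchange {Ω : Type*} [MeasurableSpace Ω]
    (μ : Measure Ω) [IsProbabilityMeasure μ] (B : ℝ) (hB : 1 ≤ B)
    (f g : ℕ → Ω → ℝ)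
    (hf_int : ∀ n, Integrable (f n) μ) (hg_int : ∀ p, Integrable (g p) μ)
    (hfg_int : ∀ n p, Integrable (fun x => f n x * g p x) μ)
    (hfluct_p : ∀ n (σ : Set Ω), MeasurableSet σ →
      HasBddFluct (fun p => ∫ x in σ, f n x * g p x ∂μ)
        (fun ε => ⌈8 * B ^ 2 * (⌈1 / ε⌉₊ : ℝ) ^ 2⌉₊))
    (hfluct_n : ∀ p (σ : Set Ω), MeasurableSet σ →
      HasBddFluct (fun n => ∫ x in σ, f n x * g p x ∂μ)
        (fun ε => ⌈8 * B ^ 2 * (⌈1 / ε⌉₊ : ℝ) ^ 2⌉₊))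
    (hf_ac : ∀ n (ε : ℝ), 0 < ε → ∀ σ : Set Ω, MeasurableSet σ →
      μ σ < ENNReal.ofReal (ε / (B * 2 ^ n)) → (∫ x in σ, |f n x| ∂μ) < ε)
    (hg_ac : ∀ p (ε : ℝ), 0 < ε → ∀ σ : Set Ω, MeasurableSet σ →
      μ σ < ENNReal.ofReal (ε / (B * 2 ^ p)) → (∫ x in σ, |g p x| ∂μ) < ε)
    (hf_norm : ∀ n, (∫ x, |f n x| ∂μ) ≤ B)
    (hg_norm : ∀ p, (∫ x, |g p x| ∂μ) ≤ B) :
    ∀ ε : ℝ, 0 < ε →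
      ∃ m s q l : ℕ, m < s ∧ q < l ∧
        s ≤ fghOmega (⌈2 ^ 22 * B ^ 4 * (⌈1 / ε⌉₊ : ℝ) ^ 4⌉₊ + 5) ∧
        l ≤ fghOmega (⌈2 ^ 22 * B ^ 4 * (⌈1 / ε⌉₊ : ℝ) ^ 4⌉₊ + 5) ∧
        |(∫ x, f m x * g s x ∂μ) - (∫ x, f l x * g q x ∂μ)| < 20 * ε := by
  intro ε hε
  have hpos : ∀ n : ℕ, 0 < B * 2 ^ n := fun n => by positivity
  choose f' hf'm hf'B hf' using fun n => exists_bounded_ae_eq (hpos n) (hf_int n) (hf_ac n)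
  choose g' hg'm hg'B hg' using fun p => exists_bounded_ae_eq (hpos p) (hg_int p) (hg_ac p)
  have hmul : ∀ n p (σ : Set Ω),
      (∫ x in σ, f' n x * g' p x ∂μ) = ∫ x in σ, f n x * g p x ∂μ := fun n p σ =>
    integral_congr_ae (ae_restrict_of_ae ((hf' n).mul (hg' p)))
  have hmul_univ : ∀ n p, (∫ x, f' n x * g' p x ∂μ) = ∫ x, f n x * g p x ∂μ := fun n p =>
    integral_congr_ae ((hf' n).mul (hg' p))
  simp only [← hmul_univ]
  refine exists_pairing_close_of_bounded hB hf'm hg'm hf'B hg'B (fun n => ?_) (fun p => ?_)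
    (fun n σ hσ => ?_) (fun p σ hσ => ?_) hε
  · exact (integral_congr_ae ((hf' n).fun_comp abs)).trans_le (hf_norm n)
  · exact (integral_congr_ae ((hg' p).fun_comp abs)).trans_le (hg_norm p)
  · simp only [hmul]
    exact hfluct_p n σ hσ
  · simp only [hmul]
    exact hfluct_n p σ hσ
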